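/- For N = 3 the six sets S_ω are explicitly: S_{Id} = {(a_1,a_2) ∈ ℤ² : a_1 ≤ a_2 ≤ 0}; S_{ω_1} = {(a_1,a_2) : a_2 + 1 ≤ a_1 ≤ 0}; S_{ω_1 ω_2} = {(a_1,a_2) : a_1 ≥ a_2 + 1 ≥ 2}; S_{ω_2 ω_1} = {(a_1,a_2) : a_1 ≤ 0 and a_2 ≥ 1}; S_{ω_2} = {(a_1,a_2) : a_1 ≥ 1 and a_2 ≤ 0}; S_{ω_2²} = {(a_1,a_2) : a_2 ≥ a_1 ≥ 1}. -/

import Mathlib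

open Matrix

noncomputable section

namespace IH

variable (p : ℕ) [Fact p.Prime]

/-- `\bar{𝔽}_p`, an algebraic closure of the residue field. -/
abbrev kb := AlgebraicClosure (ZMod p)

variable (N : ℕ)

/-- `G = GL_N(F)` with `F = ℚ_p`. -/
abbrev GG := GL (Fin N) ℚ_[p]
/-- `GL_N(O_F)` (as an abstract group, mapping onto `K ⊆ G`). -/
abbrev MM := GL (Fin N) ℤ_[p]
/-- `GL_N(k_F)`. -/
abbrev Gk := GL (Fin N) (ZMod p)

/-- The inclusion `GL_N(O_F) → GL_N(F)`. -/
def iotaM : MM p N →* GG p N := Matrix.GeneralLinearGroup.map (PadicInt.Coe.ringHom)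

/-- The reduction map `red : GL_N(O_F) → GL_N(k_F)`. -/
def redM : MM p N →* Gk p N := Matrix.GeneralLinearGroup.map (PadicInt.toZMod)

/-- Elements of `GL_N(O_F)` whose reduction is upper triangular: the Iwahori condition. -/
def Ipre : Set (MM p N) :=
  {m | ∀ i j : Fin N, j < i → ((redM p N m : Matrix (Fin N) (Fin N) (ZMod p)) i j = 0)}

/-- Elements of `GL_N(O_F)` whose reduction is upper triangular unipotent: pro-p Iwahori. -/
def I1pre : Set (MM p N) :=
  {m | m ∈ Ipre p N ∧ ∀ i : Fin N, ((redM p N m : Matrix (Fin N) (Fin N) (ZMod p)) i i = 1)}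

/-- Elements of `GL_N(O_F)` reducing to the identity: `K_1 = ker red`. -/
def K1pre : Set (MM p N) := {m | redM p N m = 1}

/-- `K = GL_N(O_F)` as a subset of `G`. -/
def Kset : Set (GG p N) := Set.range (iotaM p N)
/-- The Iwahori subgroup `I ⊆ G`. -/
def Iset : Set (GG p N) := iotaM p N '' Ipre p N
/-- The pro-p Iwahori subgroup `I_1 ⊆ G`. -/
def I1set : Set (GG p N) := iotaM p N '' I1pre p N
/-- `K_1 ⊆ G`. -/
def K1set : Set (GG p N) := iotaM p N '' K1pre p N

/-- The uniformizer `ϖ = p` as a unit of `ℚ_p`. -/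
def pU : ℚ_[p]ˣ :=
  Units.mk0 (p : ℚ_[p]) (by
    have h := (Fact.out : p.Prime).ne_zero
    exact_mod_cast Nat.cast_ne_zero.mpr h)

/-- Scalar matrices as elements of `G`. -/
def scalarGL (u : ℚ_[p]ˣ) : GG p N :=
  Units.map (algebraMap ℚ_[p] (Matrix (Fin N) (Fin N) ℚ_[p])).toMonoidHom u

/-- The central element `ϖ^n · Id`. -/
def piSc (n : ℤ) : GG p N := scalarGL p N (pU p ^ n)

/-- Invertible diagonal matrices. -/
def diagGL (d : Fin N → ℚ_[p]ˣ) : GG p N where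
  val := Matrix.diagonal fun i => (d i : ℚ_[p])
  inv := Matrix.diagonal fun i => (((d i)⁻¹ : ℚ_[p]ˣ) : ℚ_[p])
  val_inv := by
    rw [Matrix.diagonal_mul_diagonal]
    simp
  inv_val := by
    rw [Matrix.diagonal_mul_diagonal]
    simp

/-- extend `a ∈ ℤ^{N-1}` by `0` in the last coordinate. -/
def expo (a : Fin (N - 1) → ℤ) : Fin N → ℤ :=
  fun i => if h : (i : ℕ) < N - 1 then a ⟨i, h⟩ else 0

/-- `t_a = diag(ϖ^{a_1}, …, ϖ^{a_{N-1}}, 1)`. -/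
def tGL (a : Fin (N - 1) → ℤ) : GG p N :=
  diagGL p N fun i => pU p ^ (expo N a i)

/-- The permutation matrix of `σ` (with `permGL σ · e_j = e_{σ j}`, so that
`permGL` is a group homomorphism). -/
def permGL (σ : Equiv.Perm (Fin N)) : GG p N where
  val := (σ⁻¹).permMatrix ℚ_[p]
  inv := σ.permMatrix ℚ_[p]
  val_inv := by
    show ((σ⁻¹).toPEquiv.toMatrix : Matrix (Fin N) (Fin N) ℚ_[p]) * σ.toPEquiv.toMatrix = 1
    rw [← PEquiv.toMatrix_trans, ← Equiv.toPEquiv_trans]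
    simp only [Equiv.self_trans_symm, Equiv.symm_trans_self, Equiv.Perm.inv_def]
    rw [Equiv.toPEquiv_refl, PEquiv.toMatrix_refl]
  inv_val := by
    show (σ.toPEquiv.toMatrix : Matrix (Fin N) (Fin N) ℚ_[p]) * (σ⁻¹).toPEquiv.toMatrix = 1
    rw [← PEquiv.toMatrix_trans, ← Equiv.toPEquiv_trans]
    simp only [Equiv.self_trans_symm, Equiv.symm_trans_self, Equiv.Perm.inv_def]
    rw [Equiv.toPEquiv_refl, PEquiv.toMatrix_refl]

/-- `ω t_a`. -/
def wS (σ : Equiv.Perm (Fin N)) (a : Fin (N - 1) → ℤ) : GG p N :=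
  permGL p N σ * tGL p N a

/-- The permutation `ω₂` (as a matrix: first row block `(0, I_{N-1})`, last row `(1,0,…,0)`). -/
def w2 : Equiv.Perm (Fin N) := (finRotate N)⁻¹

/-- `γ = ω₂ · diag(ϖ, I_{N-1})`. -/
def gammaGL : GG p N :=
  permGL p N (w2 N) * tGL p N fun i => if (i : ℕ) = 0 then 1 else 0

/-- `S_ω = {a ∈ ℤ^{N-1} : (ω t_a) I (ω t_a)⁻¹ ∩ K ⊆ I}`. -/
def Sset (σ : Equiv.Perm (Fin N)) : Set (Fin (N - 1) → ℤ) :=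
  {a | ∀ g ∈ Iset p N,
    wS p N σ a * g * (wS p N σ a)⁻¹ ∈ Kset p N →
    wS p N σ a * g * (wS p N σ a)⁻¹ ∈ Iset p N}

/-- The unit of `k_F^×` attached to a nonzero element of `k_F` (junk value `1` at `0`). -/
def unitOf (x : ZMod p) : (ZMod p)ˣ :=
  if h : x = 0 then 1 else Units.mk0 x h

/-- The diagonal of the reduction of `m`, as an `N`-tuple of units of `k_F`. -/
def diagOf (m : MM p N) : Fin N → (ZMod p)ˣ :=
  fun i => unitOf p ((redM p N m : Matrix (Fin N) (Fin N) (ZMod p)) i i)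

/-- The transformation rule for functions in `H_{IZ}(χ)`, where the character `χ` of `I`
is given by the character `ξ` of the torus `(k_F^×)^N` through the diagonal of the
reduction, extended to `IZ` by `χ(ϖ) = 1`. -/
def HTransf (ξ : (Fin N → (ZMod p)ˣ) →* (kb p)ˣ) (φ : GG p N → kb p) : Prop :=
  ∀ (n₁ n₂ : ℤ) (m₁ m₂ : MM p N), m₁ ∈ Ipre p N → m₂ ∈ Ipre p N → ∀ g : GG p N,
    φ (piSc p N n₁ * iotaM p N m₁ * g * (piSc p N n₂ * iotaM p N m₂)) =
      (ξ (diagOf p N m₁) : kb p) * (ξ (diagOf p N m₂) : kb p) * φ g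

/-- `φ` is supported on the double coset `IZ x I`. -/
def SuppDouble (φ : GG p N → kb p) (x : GG p N) : Prop :=
  ∀ g : GG p N, φ g ≠ 0 → ∃ (n : ℤ) (m₁ m₂ : MM p N), m₁ ∈ Ipre p N ∧ m₂ ∈ Ipre p N ∧
    g = piSc p N n * iotaM p N m₁ * x * iotaM p N m₂

/-- Membership in `H_{IZ}(χ)`: the transformation rule together with support in
finitely many double cosets `IZ g I`. -/
def HMem (ξ : (Fin N → (ZMod p)ˣ) →* (kb p)ˣ) (φ : GG p N → kb p) : Prop :=
  HTransf p N ξ φ ∧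
  ∃ S : Finset (GG p N), ∀ g : GG p N, φ g ≠ 0 →
    ∃ s ∈ S, ∃ (n : ℤ) (m₁ m₂ : MM p N), m₁ ∈ Ipre p N ∧ m₂ ∈ Ipre p N ∧
      g = piSc p N n * iotaM p N m₁ * s * iotaM p N m₂

section Rep

variable {V : Type} [AddCommGroup V] [Module (kb p) V]

/-- `σ` (here `ρ`) is irreducible. -/
def IsIrred (ρ : Representation (kb p) (Gk p N) V) : Prop :=
  (∃ v : V, v ≠ 0) ∧
  ∀ W : Submodule (kb p) V, (∀ g v, v ∈ W → ρ g v ∈ W) → W = ⊥ ∨ W = ⊤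

/-- Membership in the compact induction `ind_{KZ}^G σ`: left `KZ`-equivariance
(where `ϖ` acts trivially), support in finitely many cosets `KZ g`, and smoothness. -/
def IndMem (ρ : Representation (kb p) (Gk p N) V) (f : GG p N → V) : Prop :=
  (∀ (n : ℤ) (m : MM p N) (g : GG p N),
      f (piSc p N n * iotaM p N m * g) = ρ (redM p N m) (f g)) ∧
  (∃ S : Finset (GG p N), ∀ g : GG p N, f g ≠ 0 →
      ∃ s ∈ S, ∃ (n : ℤ) (m : MM p N), g = piSc p N n * iotaM p N m * s) ∧
  (∃ U : Subgroup (GG p N), IsOpen (U : Set (GG p N)) ∧ ∀ u ∈ U, ∀ g, f (g * u) = f g)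

/-- `f` is invariant under right translation by `I_1`. -/
def IsI1Inv (f : GG p N → V) : Prop :=
  ∀ u ∈ I1set p N, ∀ g, f (g * u) = f g

/-- The defining property of the standard function `f_{ω,a}`: an `I_1`-invariant member of
`ind_{KZ}^G σ` supported on `KZ t_a I_1` with value `v₀` at `ω t_a`. -/
def IsStd (ρ : Representation (kb p) (Gk p N) V) (v₀ : V)
    (σp : Equiv.Perm (Fin N)) (a : Fin (N - 1) → ℤ) (f : GG p N → V) : Prop :=
  IndMem p N ρ f ∧ IsI1Inv p N f ∧
  (∀ g : GG p N, f g ≠ 0 → ∃ (n : ℤ) (m : MM p N) (u : GG p N), u ∈ I1set p N ∧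
      g = piSc p N n * iotaM p N m * tGL p N a * u) ∧
  f (wS p N σp a) = v₀

/-- `R` is a set of representatives for `I_1/(I_1 ∩ g⁻¹ I_1 g)`. -/
def IsRepSet (g : GG p N) (R : Finset (GG p N)) : Prop :=
  (↑R ⊆ I1set p N) ∧
  ∀ x ∈ I1set p N, ∃! r : GG p N, r ∈ R ∧
    (r⁻¹ * x ∈ I1set p N ∧ g * (r⁻¹ * x) * g⁻¹ ∈ I1set p N)

/-- The Hecke operator: `f|T_g = ∑_{r} (r g⁻¹)·f`, where `(h·f)(x) = f(xh)`. -/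
def hk (g : GG p N) (R : Finset (GG p N)) (f : GG p N → V) : GG p N → V :=
  fun x => ∑ r ∈ R, f (x * r * g⁻¹)

end Rep


/-- The transvection `1 + c E_{ij}` as an element of `GL_N(O_F)`. -/
def transvectionGL {i j : Fin N} (h : i ≠ j) (c : ℤ_[p]) : MM p N where
  val := Matrix.transvection i j c
  inv := Matrix.transvection i j (-c)
  val_inv := by rw [Matrix.transvection_mul_transvection_same _ _ h]; simp
  inv_val := by rw [Matrix.transvection_mul_transvection_same _ _ h]; simp

variable {p N}

theorem transvectionGL_apply {i j : Fin N} (h : i ≠ j) (c : ℤ_[p]) (k l : Fin N) :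
    transvectionGL p N h c k l = (if k = l then 1 else 0) + if i = k ∧ j = l then c else 0 := by
  rw [← Matrix.one_apply, ← Matrix.single_apply, ← Matrix.add_apply]
  rfl

theorem iotaM_apply (m : MM p N) (i j : Fin N) : iotaM p N m i j = ((m i j : ℤ_[p]) : ℚ_[p]) :=
  rfl

theorem mem_Ipre_iff (m : MM p N) : m ∈ Ipre p N ↔ ∀ i j : Fin N, j < i → ‖m i j‖ < 1 := by
  refine forall_congr' fun i => forall_congr' fun j => imp_congr_right fun _ => ?_
  change PadicInt.toZMod (m i j) = 0 ↔ _
  rw [← RingHom.mem_ker, PadicInt.ker_toZMod, IsLocalRing.mem_maximalIdeal, PadicInt.mem_nonunits]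

theorem wS_conj_apply (σ : Equiv.Perm (Fin N)) (a : Fin (N - 1) → ℤ) (g : GG p N) (i j : Fin N) :
    (wS p N σ a * g * (wS p N σ a)⁻¹) i j =
      (p : ℚ_[p]) ^ (expo N a (σ⁻¹ i) - expo N a (σ⁻¹ j)) * g (σ⁻¹ i) (σ⁻¹ j) := by
  have hp : (p : ℚ_[p]) ≠ 0 := Nat.cast_ne_zero.mpr (Fact.out : p.Prime).ne_zero
  have hconj : ((wS p N σ a * g * (wS p N σ a)⁻¹ : GG p N) : Matrix (Fin N) (Fin N) ℚ_[p]) =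
      (σ⁻¹).permMatrix ℚ_[p] * (Matrix.diagonal (fun i => ((pU p ^ expo N a i : ℚ_[p]ˣ) : ℚ_[p])) *
        (g : Matrix (Fin N) (Fin N) ℚ_[p]) *
        Matrix.diagonal (fun i => (((pU p ^ expo N a i)⁻¹ : ℚ_[p]ˣ) : ℚ_[p]))) *
        σ.permMatrix ℚ_[p] := by
    rw [wS, _root_.mul_inv_rev]
    simp only [Units.val_mul, Matrix.mul_assoc]
    rfl
  rw [hconj, Equiv.Perm.permMatrix, Equiv.Perm.permMatrix, PEquiv.toMatrix_toPEquiv_mul,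
    PEquiv.mul_toMatrix_toPEquiv]
  simp only [Matrix.submatrix_apply, id, Matrix.mul_diagonal, Matrix.diagonal_mul,
    Units.val_inv_eq_inv_val, Units.val_zpow_eq_zpow_val, pU, Units.val_mk0, zpow_sub₀ hp,
    Equiv.Perm.inv_def]
  ring

/-- `a ∈ S_σ` iff every entry below the diagonal of an element of `(σ t_a) I (σ t_a)⁻¹` has positive
valuation. -/
theorem mem_Sset_iff (σ : Equiv.Perm (Fin N)) (a : Fin (N - 1) → ℤ) :
    a ∈ Sset p N σ ↔ ∀ i j : Fin N, j < i →
      (if σ⁻¹ i < σ⁻¹ j then 1 else 0) ≤ expo N a (σ⁻¹ i) - expo N a (σ⁻¹ j) := by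
  have hp : (p : ℚ_[p]) ≠ 0 := Nat.cast_ne_zero.mpr (Fact.out : p.Prime).ne_zero
  have hp1 : (1 : ℝ) < p := by exact_mod_cast (Fact.out : p.Prime).one_lt
  constructor
  · intro ha i j hij
    by_contra! hlt
    have hkl : σ⁻¹ i ≠ σ⁻¹ j := fun h => hij.ne' (σ⁻¹.injective h)
    obtain ⟨n, hn⟩ : ∃ n : ℕ, expo N a (σ⁻¹ i) - expo N a (σ⁻¹ j) = -n :=
      ⟨(-(expo N a (σ⁻¹ i) - expo N a (σ⁻¹ j))).toNat, by split_ifs at hlt <;> omega⟩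
    have hmem : transvectionGL p N hkl ((p : ℤ_[p]) ^ n) ∈ Ipre p N := by
      rw [mem_Ipre_iff]
      intro k l hlk
      rw [transvectionGL_apply, if_neg hlk.ne', zero_add]
      split_ifs with h
      · obtain ⟨rfl, rfl⟩ := h
        rw [if_neg hlk.not_gt] at hlt
        rw [PadicInt.norm_p_pow]
        exact zpow_lt_one_of_neg₀ hp1 (by omega)
      · simp
    have heq : wS p N σ a * iotaM p N (transvectionGL p N hkl ((p : ℤ_[p]) ^ n)) * (wS p N σ a)⁻¹ =
        iotaM p N (transvectionGL p N hij.ne' 1) := by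
      ext k l
      rw [wS_conj_apply, iotaM_apply, iotaM_apply, transvectionGL_apply, transvectionGL_apply]
      simp only [σ⁻¹.injective.eq_iff]
      by_cases hkl' : k = l
      · subst hkl'
        have : ¬ (i = k ∧ j = k) := fun h => hij.ne' (h.1.trans h.2.symm)
        simp [this]
      · by_cases h : i = k ∧ j = l
        · obtain ⟨rfl, rfl⟩ := h
          rw [hn]
          simp [hkl', hp]
        · simp [hkl', h]
    have hI := ha _ ⟨_, hmem, rfl⟩ (heq ▸ ⟨_, rfl⟩)
    rw [heq] at hI
    obtain ⟨m, hm, hme⟩ := hI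
    have hnorm := (mem_Ipre_iff m).1 hm i j hij
    have hentry : ((m i j : ℤ_[p]) : ℚ_[p]) = 1 := by
      rw [← iotaM_apply, hme, iotaM_apply, transvectionGL_apply]
      simp [hij.ne']
    rw [PadicInt.norm_def, hentry, norm_one] at hnorm
    exact lt_irrefl _ hnorm
  · rintro h _ ⟨m, hm, rfl⟩ ⟨m', hm'⟩
    rw [← hm']
    refine ⟨m', (mem_Ipre_iff m').2 fun i j hij => ?_, rfl⟩
    have hkl : σ⁻¹ i ≠ σ⁻¹ j := fun h => hij.ne' (σ⁻¹.injective h)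
    rw [PadicInt.norm_def, ← iotaM_apply, hm', wS_conj_apply, norm_mul, Padic.norm_p_zpow,
      iotaM_apply, ← PadicInt.norm_def]
    have hval := h i j hij
    split_ifs at hval with hlt
    · exact mul_lt_one_of_nonneg_of_lt_one_left (by positivity)
        (zpow_lt_one_of_neg₀ hp1 (by omega)) (PadicInt.norm_le_one _)
    · exact mul_lt_one_of_nonneg_of_lt_one_right
        (zpow_le_one_of_nonpos₀ hp1.le (by omega)) (norm_nonneg _)
        ((mem_Ipre_iff m).1 hm _ _ (lt_of_le_of_ne (not_lt.1 hlt) hkl.symm))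

/-- For `N = 3`, the inequalities cutting out `S_σ`, in terms of the values of `σ⁻¹`. -/
theorem mem_Sset_three_iff (σ : Equiv.Perm (Fin 3)) (a : Fin 2 → ℤ) {x y z : Fin 3}
    (hx : σ⁻¹ 0 = x) (hy : σ⁻¹ 1 = y) (hz : σ⁻¹ 2 = z) :
    a ∈ Sset p 3 σ ↔
      (if y < x then 1 else 0) ≤ expo 3 a y - expo 3 a x ∧
      (if z < x then 1 else 0) ≤ expo 3 a z - expo 3 a x ∧
      (if z < y then 1 else 0) ≤ expo 3 a z - expo 3 a y := by
  subst hx hy hz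
  rw [mem_Sset_iff]
  simp [Fin.forall_fin_succ]

/-- the six sets `S_ω` for `N = 3`, explicitly. -/
theorem stmt7 (p : ℕ) [Fact p.Prime] :
    Sset p 3 1 = {a : Fin 2 → ℤ | a 0 ≤ a 1 ∧ a 1 ≤ 0} ∧
    Sset p 3 (Equiv.swap (0 : Fin 3) 1) = {a : Fin 2 → ℤ | a 1 + 1 ≤ a 0 ∧ a 0 ≤ 0} ∧
    Sset p 3 (Equiv.swap (0 : Fin 3) 1 * w2 3) =
      {a : Fin 2 → ℤ | a 1 + 1 ≤ a 0 ∧ 2 ≤ a 1 + 1} ∧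
    Sset p 3 (w2 3 * Equiv.swap (0 : Fin 3) 1) = {a : Fin 2 → ℤ | a 0 ≤ 0 ∧ 1 ≤ a 1} ∧
    Sset p 3 (w2 3) = {a : Fin 2 → ℤ | 1 ≤ a 0 ∧ a 1 ≤ 0} ∧
    Sset p 3 (w2 3 * w2 3) = {a : Fin 2 → ℤ | 1 ≤ a 0 ∧ a 0 ≤ a 1} := by
  have e0 (a : Fin 2 → ℤ) : expo 3 a 0 = a 0 := rfl
  have e1 (a : Fin 2 → ℤ) : expo 3 a 1 = a 1 := rfl
  have e2 (a : Fin 2 → ℤ) : expo 3 a 2 = 0 := rfl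
  refine ⟨?_, ?_, ?_, ?_, ?_, ?_⟩ <;> ext a
  · rw [mem_Sset_three_iff (x := 0) (y := 1) (z := 2) _ _ (by decide) (by decide) (by decide)]
    simp [e0, e1, e2]
    omega
  · rw [mem_Sset_three_iff (x := 1) (y := 0) (z := 2) _ _ (by decide) (by decide) (by decide)]
    simp [e0, e1, e2]
    omega
  · rw [mem_Sset_three_iff (x := 2) (y := 1) (z := 0) _ _ (by decide) (by decide) (by decide)]
    simp [e0, e1, e2]
    omega
  · rw [mem_Sset_three_iff (x := 0) (y := 2) (z := 1) _ _ (by decide) (by decide) (by decide)]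
    simp [e0, e1, e2]
    omega
  · rw [mem_Sset_three_iff (x := 1) (y := 2) (z := 0) _ _ (by decide) (by decide) (by decide)]
    simp [e0, e1, e2]
    omega
  · rw [mem_Sset_three_iff (x := 2) (y := 0) (z := 1) _ _ (by decide) (by decide) (by decide)]
    simp [e0, e1, e2]
    omega

end IH
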